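/- Let β ∈ [0,1), δ ∈ [0,1), p, r ∈ [0,1] with r < p and p − r < 1, Q(x) = x·p + (1−x)·r, and let R : [0,1] → ℝ be convex and continuous with R(0) = δ, R(1) = 1 and max{δ, π} ≤ R(π) ≤ (1−δ)·π + δ for all π ∈ [0,1]. For each ω ∈ ℝ, let V_ω be the unique bounded solution of the Bellman equation V_ω(π) = max{ R(π) + β·( π·V_ω(p) + (1−π)·V_ω(r) ), ω + β·V_ω(Q(π)) }. Then for every π ∈ [0,1] with π ≥ p, the Whittle index W(π) := inf{ ω ∈ ℝ : ω + β·V_ω(Q(π)) ≥ R(π) + β·( π·V_ω(p) + (1−π)·V_ω(r) ) } equals R(π). -/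

import Mathlib

open Set

/-- A real number bounded by `K * β ^ n` for every `n`, with `0 ≤ β < 1`, is nonpositive. -/
lemma nonpos_of_forall_le_geometric {β K d : ℝ} (h0 : 0 ≤ β) (h1 : β < 1)
    (h : ∀ n : ℕ, d ≤ K * β ^ n) : d ≤ 0 := by
  have hlim := (tendsto_pow_atTop_nhds_zero_of_lt_one h0 h1).const_mul K
  rw [mul_zero] at hlim
  exact ge_of_tendsto' hlim h

/-- A convex function on `[0, 1]` minimized at `0` is monotone there. -/
lemma ConvexOn.monotoneOn_Icc_of_forall_zero_le {R : ℝ → ℝ} (hR : ConvexOn ℝ (Icc (0:ℝ) 1) R)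
    (hmin : ∀ x ∈ Icc (0:ℝ) 1, R 0 ≤ R x) : MonotoneOn R (Icc (0:ℝ) 1) := by
  intro x hx y hy hxy
  rcases hx.1.eq_or_lt with h | hx0
  · exact h ▸ hmin y hy
  · exact (hR.le_max_of_mem_Icc (by simp) hy ⟨hx.1, hxy⟩).trans (max_le (hmin y hy) le_rfl)

/-- The belief update is a convex combination of `p` and `r`, hence lies between them. -/
lemma convexCombo_mem_Icc {p r x : ℝ} (hrp : r ≤ p) (hx : x ∈ Icc (0:ℝ) 1) :
    x * p + (1 - x) * r ∈ Icc r p := by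
  constructor <;> nlinarith [hx.1, hx.2]

section Bellman

variable {β p r ω : ℝ} {R v : ℝ → ℝ}

/-- A bounded solution of the Bellman equation with convex reward is convex. -/
lemma convexOn_of_bellman (hβ : β ∈ Ico (0:ℝ) 1) (hp : p ∈ Icc (0:ℝ) 1) (hr : r ∈ Icc (0:ℝ) 1)
    (hrp : r ≤ p) (hR : ConvexOn ℝ (Icc (0:ℝ) 1) R)
    (hbd : ∃ C : ℝ, ∀ x ∈ Icc (0:ℝ) 1, |v x| ≤ C)
    (hv : ∀ x ∈ Icc (0:ℝ) 1,
      v x = max (R x + β * (x * v p + (1 - x) * v r)) (ω + β * v (x * p + (1 - x) * r))) :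
    ConvexOn ℝ (Icc (0:ℝ) 1) v := by
  obtain ⟨C, hC⟩ := hbd
  refine ⟨convex_Icc 0 1, fun x hx y hy a b ha hb hab => ?_⟩
  have key : ∀ n : ℕ, ∀ x ∈ Icc (0:ℝ) 1, ∀ y ∈ Icc (0:ℝ) 1,
      v (a * x + b * y) - (a * v x + b * v y) ≤ (2 * C) * β ^ n := by
    intro n
    induction n with
    | zero =>
      intro x hx y hy
      have hz : a * x + b * y ∈ Icc (0:ℝ) 1 := convex_Icc 0 1 hx hy ha hb hab
      have h1 := (abs_le.1 (hC _ hz)).2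
      have h2 := mul_le_mul_of_nonneg_left (abs_le.1 (hC x hx)).1 ha
      have h3 := mul_le_mul_of_nonneg_left (abs_le.1 (hC y hy)).1 hb
      have h4 : a * -C + b * -C = -C := by rw [← add_mul, hab, one_mul]
      rw [pow_zero]
      linarith
    | succ n ih =>
      intro x hx y hy
      have hz : a * x + b * y ∈ Icc (0:ℝ) 1 := convex_Icc 0 1 hx hy ha hb hab
      have hC0 : 0 ≤ C := (abs_nonneg _).trans (hC x hx)
      have hQ : ∀ x ∈ Icc (0:ℝ) 1, x * p + (1 - x) * r ∈ Icc (0:ℝ) 1 := fun x hx =>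
        Icc_subset_Icc hr.1 hp.2 (convexCombo_mem_Icc hrp hx)
      obtain rfl : b = 1 - a := by linarith
      rw [sub_le_iff_le_add, hv _ hz]
      apply max_le
      · have hRz := hR.2 hx hy ha hb hab
        simp only [smul_eq_mul] at hRz
        have h2 := mul_le_mul_of_nonneg_left ((le_max_left _ _).trans_eq (hv x hx).symm) ha
        have h3 := mul_le_mul_of_nonneg_left ((le_max_left _ _).trans_eq (hv y hy).symm) hb
        have h4 : 0 ≤ 2 * C * β ^ (n + 1) := mul_nonneg (by linarith) (pow_nonneg hβ.1 _)
        linarith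
      · have h2 := mul_le_mul_of_nonneg_left ((le_max_right _ _).trans_eq (hv x hx).symm) ha
        have h3 := mul_le_mul_of_nonneg_left ((le_max_right _ _).trans_eq (hv y hy).symm) hb
        have h4 := mul_le_mul_of_nonneg_left (ih _ (hQ x hx) _ (hQ y hy)) hβ.1
        have h5 : a * (x * p + (1 - x) * r) + (1 - a) * (y * p + (1 - y) * r)
            = (a * x + (1 - a) * y) * p + (1 - (a * x + (1 - a) * y)) * r := by ring
        rw [h5] at h4
        rw [pow_succ]
        linarith
  have := nonpos_of_forall_le_geometric hβ.1 hβ.2 fun n => key n x hx y hy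
  simp only [smul_eq_mul]
  linarith

/-- If the reward never exceeds the subsidy on `[0, s]` with `p ≤ s`, then idling forever is
optimal there, and the value is `c = ω / (1 - β)`. -/
lemma eq_of_bellman_of_reward_le {s c : ℝ} (hβ : β ∈ Ico (0:ℝ) 1) (hr : 0 ≤ r) (hrp : r ≤ p)
    (hps : p ≤ s) (hs : s ≤ 1) (hRω : ∀ x ∈ Icc 0 s, R x ≤ ω) (hc : c = ω + β * c)
    (hbd : ∃ C : ℝ, ∀ x ∈ Icc (0:ℝ) 1, |v x| ≤ C)
    (hv : ∀ x ∈ Icc (0:ℝ) 1,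
      v x = max (R x + β * (x * v p + (1 - x) * v r)) (ω + β * v (x * p + (1 - x) * r)))
    {x : ℝ} (hx : x ∈ Icc 0 s) : v x = c := by
  obtain ⟨C, hC⟩ := hbd
  have hsub : Icc 0 s ⊆ Icc (0:ℝ) 1 := Icc_subset_Icc le_rfl hs
  have key : ∀ n : ℕ, ∀ x ∈ Icc 0 s, |v x - c| ≤ (C + |c|) * β ^ n := by
    intro n
    induction n with
    | zero =>
      intro x hx
      rw [pow_zero, mul_one]
      exact (abs_sub _ _).trans (add_le_add (hC x (hsub hx)) le_rfl)
    | succ n ih =>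
      intro x hx
      have hx1 := hsub hx
      have hQ : x * p + (1 - x) * r ∈ Icc 0 s :=
        Icc_subset_Icc hr hps (convexCombo_mem_Icc hrp hx1)
      have hq := abs_le.1 (ih _ hQ)
      have hvp := (abs_le.1 (ih p ⟨hr.trans hrp, hps⟩)).2
      have hvr := (abs_le.1 (ih r ⟨hr, hrp.trans hps⟩)).2
      have hql := mul_le_mul_of_nonneg_left hq.1 hβ.1
      have hqu := mul_le_mul_of_nonneg_left hq.2 hβ.1
      rw [pow_succ, abs_le]
      constructor
      · have := (le_max_right _ _).trans_eq (hv x hx1).symm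
        linarith
      · rw [sub_le_iff_le_add, hv x hx1]
        apply max_le
        · have h1 := mul_le_mul_of_nonneg_left hvp hx1.1
          have h2 := mul_le_mul_of_nonneg_left hvr (sub_nonneg.2 hx1.2)
          have h3 := mul_le_mul_of_nonneg_left (add_le_add h1 h2) hβ.1
          linarith [hRω x hx]
        · linarith
  exact sub_eq_zero.1 <| abs_nonpos_iff.1 <|
    nonpos_of_forall_le_geometric hβ.1 hβ.2 fun n => key n x hx

end Bellman

/-- First case of Proposition 4 (positively correlated channel): for beliefs `π ≥ p`, the
Whittle index equals the immediate reward, `W(π) = R(π)`. -/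
theorem stmt_18 (β δ : ℝ) (hβ : β ∈ Ico (0:ℝ) 1) (hδ : δ ∈ Ico (0:ℝ) 1)
    (p r : ℝ) (hp : p ∈ Icc (0:ℝ) 1) (hr : r ∈ Icc (0:ℝ) 1)
    (hrp : r < p) (hpr : p - r < 1)
    (Q : ℝ → ℝ) (hQ : ∀ x, Q x = x * p + (1 - x) * r)
    (R : ℝ → ℝ) (hRconv : ConvexOn ℝ (Icc (0:ℝ) 1) R)
    (hRcont : ContinuousOn R (Icc (0:ℝ) 1))
    (hR0 : R 0 = δ) (hR1 : R 1 = 1)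
    (hRbounds : ∀ π ∈ Icc (0:ℝ) 1, max δ π ≤ R π ∧ R π ≤ (1 - δ) * π + δ)
    (V : ℝ → ℝ → ℝ)
    (hVbd : ∀ ω : ℝ, ∃ C : ℝ, ∀ π ∈ Icc (0:ℝ) 1, |V ω π| ≤ C)
    (hV : ∀ ω : ℝ, ∀ π ∈ Icc (0:ℝ) 1,
      V ω π = max (R π + β * (π * V ω p + (1 - π) * V ω r)) (ω + β * V ω (Q π))) :
    ∀ π ∈ Icc (0:ℝ) 1, p ≤ π →
      sInf {ω : ℝ |
        R π + β * (π * V ω p + (1 - π) * V ω r) ≤ ω + β * V ω (Q π)} = R π := by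
  intro π hπ hpπ
  obtain rfl : Q = fun x => x * p + (1 - x) * r := funext hQ
  have hmono : MonotoneOn R (Icc (0:ℝ) 1) :=
    hRconv.monotoneOn_Icc_of_forall_zero_le fun x hx =>
      hR0.trans_le ((le_max_left _ _).trans (hRbounds x hx).1)
  refine IsLeast.csInf_eq ⟨?_, fun ω hω => ?_⟩
  · have hconst : ∀ x ∈ Icc 0 π, V (R π) x = R π / (1 - β) := fun x hx =>
      eq_of_bellman_of_reward_le hβ hr.1 hrp.le hpπ hπ.2
        (fun y hy => hmono ⟨hy.1, hy.2.trans hπ.2⟩ hπ hy.2)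
        (by have : 1 - β ≠ 0 := (sub_pos.2 hβ.2).ne'
            field_simp
            ring)
        (hVbd _) (hV _) hx
    simp only [mem_ofPred_eq]
    rw [hconst p ⟨hp.1, hpπ⟩, hconst r ⟨hr.1, hrp.le.trans hpπ⟩,
      hconst _ (Icc_subset_Icc hr.1 hpπ (convexCombo_mem_Icc hrp.le hπ))]
    exact le_of_eq (by ring)
  · have hconv := (convexOn_of_bellman hβ hp hr hrp.le hRconv (hVbd ω) (hV ω)).2 hp hr hπ.1
      (sub_nonneg.2 hπ.2) (by ring)
    simp only [smul_eq_mul] at hconv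
    have := mul_le_mul_of_nonneg_left hconv hβ.1
    simp only [mem_ofPred_eq] at hω
    linarith
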